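/- Weighted Hellinger distance is dominated by the order-1/2 α-divergence: Under the hypotheses of Lemma 3.1 (the family {p_θ : θ ∈ Θ} is convex and θ* ∈ Θ minimizes the KL divergence D(p_{θ0}, p_θ) over Θ, all KL divergences finite), define the squared weighted Hellinger distance h_w²(θ, θ*) = (1/4) ∫ (√p_{θ*} − √p_θ)² · (p_{θ0}/p_{θ*}) dμ. Then for every θ ∈ Θ: 4·h_w²(θ, θ*) ≤ 2·[1 − ∫ (p_θ/p_{θ*})^{1/2} p_{θ0} dμ] ≤ D_{θ0,1/2}(θ, θ*). -/

import Mathlib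

open MeasureTheory Filter Set
open scoped ENNReal NNReal

noncomputable section

/-- The α-affinity `A_{θ0,α}(θ, θ') = ∫ (p_θ/p_{θ'})^α p_{θ0} dμ`. -/
def alphaAff {X Θ : Type*} [MeasurableSpace X]
    (μ : Measure X) (p : Θ → X → ℝ) (p0 : X → ℝ) (α : ℝ) (θ θ' : Θ) : ℝ :=
  ∫ x, (p θ x / p θ' x) ^ α * p0 x ∂μ

/-- The α-divergence `D_{θ0,α}(θ, θ') = (α-1)⁻¹ log A_{θ0,α}(θ, θ')`. -/
def alphaDiv {X Θ : Type*} [MeasurableSpace X]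
    (μ : Measure X) (p : Θ → X → ℝ) (p0 : X → ℝ) (α : ℝ) (θ θ' : Θ) : ℝ :=
  (α - 1)⁻¹ * Real.log (alphaAff μ p p0 α θ θ')

/-- The KL divergence `D(p0, q) = ∫ p0 log(p0/q) dμ`. -/
def klDivFn {X : Type*} [MeasurableSpace X] (μ : Measure X) (p0 q : X → ℝ) : ℝ :=
  ∫ x, p0 x * Real.log (p0 x / q x) ∂μ

/-- The squared weighted Hellinger distance
`h_w²(θ, θ*) = (1/4) ∫ (√p_{θ*} − √p_θ)² (p_{θ0}/p_{θ*}) dμ`. -/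
def weightedHellingerSq {X Θ : Type*} [MeasurableSpace X]
    (μ : Measure X) (p : Θ → X → ℝ) (p0 : X → ℝ) (θstar θ : Θ) : ℝ :=
  (1 / 4) * ∫ x, (Real.sqrt (p θstar x) - Real.sqrt (p θ x)) ^ 2 * (p0 x / p θstar x) ∂μ

open scoped Topology

/-- Fatou's lemma for the Bochner integral of nonnegative real functions. -/
theorem integrable_and_integral_le_of_tendsto {X ι : Type*} [MeasurableSpace X] {P : Measure X}
    {l : Filter ι} [l.NeBot] [l.IsCountablyGenerated] {F : ι → X → ℝ} {G : X → ℝ} {C : ℝ}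
    (hFm : ∀ i, Measurable (F i)) (hGm : AEStronglyMeasurable G P)
    (hF : ∀ᶠ i in l, 0 ≤ᵐ[P] F i ∧ Integrable (F i) P ∧ ∫ x, F i x ∂P ≤ C)
    (hG : 0 ≤ᵐ[P] G)
    (hlim : ∀ᵐ x ∂P, Tendsto (fun i => F i x) l (𝓝 (G x))) :
    Integrable G P ∧ ∫ x, G x ∂P ≤ C := by
  obtain ⟨i, hi_nonneg, -, hi_le⟩ := hF.exists
  have hC : 0 ≤ C := (integral_nonneg_of_ae hi_nonneg).trans hi_le
  have hle : ∫⁻ x, ENNReal.ofReal (G x) ∂P ≤ ENNReal.ofReal C := by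
    calc ∫⁻ x, ENNReal.ofReal (G x) ∂P
        = ∫⁻ x, liminf (fun i => ENNReal.ofReal (F i x)) l ∂P := by
          refine lintegral_congr_ae ?_
          filter_upwards [hlim] with x hx
          exact (ENNReal.tendsto_ofReal hx).liminf_eq.symm
      _ ≤ liminf (fun i => ∫⁻ x, ENNReal.ofReal (F i x) ∂P) l :=
          lintegral_liminf_le fun i => (hFm i).ennreal_ofReal
      _ ≤ ENNReal.ofReal C := by
          refine liminf_le_of_frequently_le' (Eventually.frequently ?_)
          filter_upwards [hF] with i hi
          rw [← ofReal_integral_eq_lintegral_ofReal hi.2.1 hi.1]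
          exact ENNReal.ofReal_le_ofReal hi.2.2
  have hint : Integrable G P :=
    ⟨hGm, (hasFiniteIntegral_iff_ofReal hG).2 (hle.trans_lt ENNReal.ofReal_lt_top)⟩
  refine ⟨hint, ?_⟩
  rwa [← ofReal_integral_eq_lintegral_ofReal hint hG, ENNReal.ofReal_le_ofReal_iff hC] at hle

/-- If `1` maximizes the expected logarithm along the segment from `1` to `r`, then `r` is
integrable with mean at most `1`. -/
theorem integrable_and_integral_le_one_of_integral_log_nonpos {X : Type*} [MeasurableSpace X]
    {P : Measure X} [IsProbabilityMeasure P] {r : X → ℝ} (hr : Measurable r)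
    (hpos : ∀ᵐ x ∂P, 0 < r x) (hlog : Integrable (fun x => Real.log (r x)) P)
    (hmix : ∀ t : ℝ, 0 < t → t < 1 →
      Integrable (fun x => Real.log (1 + t * (r x - 1))) P ∧
        ∫ x, Real.log (1 + t * (r x - 1)) ∂P ≤ 0) :
    Integrable r P ∧ ∫ x, r x ∂P ≤ 1 := by
  have key := integrable_and_integral_le_of_tendsto (P := P) (l := 𝓝[>] (0 : ℝ))
    (F := fun t x => t⁻¹ * Real.log (1 + t * (r x - 1)) - Real.log (r x))
    (G := fun x => r x - 1 - Real.log (r x)) (C := -∫ x, Real.log (r x) ∂P)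
    (fun t => by fun_prop) (by fun_prop) ?_ ?_ ?_
  · obtain ⟨hint, hle⟩ := key
    have hr_int : Integrable r P := by
      refine ((hint.add hlog).add (integrable_const 1)).congr (ae_of_all _ fun x => ?_)
      simp
    refine ⟨hr_int, ?_⟩
    have hsub : Integrable (fun x => r x - 1) P := hr_int.sub (integrable_const 1)
    rw [integral_sub hsub hlog,
      integral_sub hr_int (integrable_const 1)] at hle
    simp only [integral_const, probReal_univ, smul_eq_mul, mul_one] at hle
    linarith
  · filter_upwards [Ioo_mem_nhdsGT (zero_lt_one' ℝ)] with t ⟨ht0, ht1⟩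
    obtain ⟨hint, hle⟩ := hmix t ht0 ht1
    refine ⟨?_, (hint.const_mul _).sub hlog, ?_⟩
    · filter_upwards [hpos] with x hx
      have hconc := strictConcaveOn_log_Ioi.concaveOn.2 (mem_Ioi.2 hx)
        (mem_Ioi.2 (zero_lt_one' ℝ)) ht0.le (sub_nonneg.2 ht1.le) (by ring)
      simp only [smul_eq_mul, Real.log_one, mul_zero, add_zero, mul_one] at hconc
      rw [show t * r x + (1 - t) = 1 + t * (r x - 1) by ring] at hconc
      have := (le_inv_mul_iff₀ ht0).2 hconc
      simpa using this
    · rw [integral_sub (hint.const_mul _) hlog, integral_const_mul]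
      have := mul_nonpos_of_nonneg_of_nonpos (inv_nonneg.2 ht0.le) hle
      linarith
  · filter_upwards [hpos] with x hx
    simpa using Real.log_le_sub_one_of_pos hx
  · refine ae_of_all _ fun x => ?_
    have hd : HasDerivAt (fun t : ℝ => Real.log (1 + t * (r x - 1))) (r x - 1) 0 := by
      have h := (((hasDerivAt_id (0 : ℝ)).mul_const (r x - 1)).const_add 1).log (by simp)
      simpa using h
    simpa using hd.tendsto_slope_zero_right.sub_const (Real.log (r x))

/-- A positive `r` with mean at most `1` satisfies `E (1 - √r)² ≤ 2 (1 - E √r)` and `0 < E √r`. -/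
theorem integral_one_sub_sqrt_sq_le_and_integral_sqrt_pos {X : Type*} [MeasurableSpace X]
    {P : Measure X} [IsProbabilityMeasure P] {r : X → ℝ} (hpos : ∀ᵐ x ∂P, 0 < r x)
    (hint : Integrable r P) (hle : ∫ x, r x ∂P ≤ 1) :
    ∫ x, (1 - √(r x)) ^ 2 ∂P ≤ 2 * (1 - ∫ x, √(r x) ∂P) ∧ 0 < ∫ x, √(r x) ∂P := by
  have hsqrt : Integrable (fun x => √(r x)) P := by
    refine (hint.add (integrable_const 1)).mono'
      (Real.continuous_sqrt.comp_aestronglyMeasurable hint.1) ?_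
    filter_upwards [hpos] with x hx
    rw [Real.norm_of_nonneg (Real.sqrt_nonneg _), Pi.add_apply]
    nlinarith [Real.sq_sqrt hx.le, sq_nonneg (√(r x) - 1), Real.sqrt_nonneg (r x)]
  constructor
  · have heq : ∫ x, (1 - √(r x)) ^ 2 ∂P = ∫ x, (1 - 2 * √(r x) + r x) ∂P := by
      refine integral_congr_ae ?_
      filter_upwards [hpos] with x hx
      linear_combination Real.sq_sqrt hx.le
    have hsub : Integrable (fun x => 1 - 2 * √(r x)) P :=
      (integrable_const 1).sub (hsqrt.const_mul 2)
    rw [heq, integral_add hsub hint,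
      integral_sub (integrable_const 1) (hsqrt.const_mul 2), integral_const_mul]
    simp only [integral_const, probReal_univ, smul_eq_mul, mul_one]
    linarith
  · have hnn : 0 ≤ᵐ[P] fun x => √(r x) := ae_of_all _ fun x => Real.sqrt_nonneg _
    refine (integral_nonneg_of_ae hnn).lt_of_ne' fun h0 => ?_
    obtain ⟨x, hx, hx0⟩ := (hpos.and ((integral_eq_zero_iff_of_nonneg_ae hnn hsqrt).1 h0)).exists
    exact (Real.sqrt_pos.2 hx).ne' hx0

/-- The weighted Hellinger distance is dominated by the order-1/2 α-divergence. -/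
theorem weighted_hellinger_le_half_alpha_div
    {X Θ : Type*} [MeasurableSpace X]
    (μ : Measure X) [SigmaFinite μ]
    (p : Θ → X → ℝ) (p0 : X → ℝ)
    (hp_meas : ∀ θ, Measurable (p θ)) (hp0_meas : Measurable p0)
    (hp_nonneg : ∀ θ x, 0 ≤ p θ x) (hp0_nonneg : ∀ x, 0 ≤ p0 x)
    (hp_dens : ∀ θ, ∫ x, p θ x ∂μ = 1) (hp0_dens : ∫ x, p0 x ∂μ = 1)
    (hp_pos : ∀ θ : Θ,
      ∀ᵐ x ∂(μ.withDensity fun x => ENNReal.ofReal (p0 x)), 0 < p θ x)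
    (hconvex : ∀ θ θ' : Θ, ∀ ω : ℝ, 0 < ω → ω < 1 →
      ∃ θbar : Θ, ∀ᵐ x ∂μ, p θbar x = ω * p θ x + (1 - ω) * p θ' x)
    (hKL_int : ∀ θ : Θ, Integrable (fun x => p0 x * Real.log (p0 x / p θ x)) μ)
    (θstar : Θ) (hθstar : ∀ θ : Θ, klDivFn μ p0 (p θstar) ≤ klDivFn μ p0 (p θ)) :
    ∀ θ : Θ,
      4 * weightedHellingerSq μ p p0 θstar θ ≤
          2 * (1 - ∫ x, (p θ x / p θstar x) ^ ((1 : ℝ) / 2) * p0 x ∂μ) ∧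
      2 * (1 - ∫ x, (p θ x / p θstar x) ^ ((1 : ℝ) / 2) * p0 x ∂μ) ≤
          alphaDiv μ p p0 (1 / 2) θ θstar := by
  intro θ
  set P := μ.withDensity fun x => ENNReal.ofReal (p0 x) with hP
  have hp0_int : Integrable p0 μ := by
    by_contra h
    rw [integral_undef h] at hp0_dens
    exact zero_ne_one hp0_dens
  have : IsProbabilityMeasure P := ⟨by
    rw [hP, withDensity_apply _ MeasurableSet.univ, setLIntegral_univ,
      ← ofReal_integral_eq_lintegral_ofReal hp0_int (ae_of_all _ hp0_nonneg), hp0_dens,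
      ENNReal.ofReal_one]⟩
  have hfin : ∀ᵐ x ∂μ, ENNReal.ofReal (p0 x) < ∞ := ae_of_all _ fun _ => ENNReal.ofReal_lt_top
  have hint_iff (g : X → ℝ) : Integrable g P ↔ Integrable (fun x => p0 x * g x) μ := by
    rw [hP, integrable_withDensity_iff_integrable_smul' hp0_meas.ennreal_ofReal hfin]
    simp only [ENNReal.toReal_ofReal (hp0_nonneg _), smul_eq_mul]
  have hint_eq (g : X → ℝ) : ∫ x, g x ∂P = ∫ x, p0 x * g x ∂μ := by
    rw [hP, integral_withDensity_eq_integral_toReal_smul hp0_meas.ennreal_ofReal hfin]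
    simp only [ENNReal.toReal_ofReal (hp0_nonneg _), smul_eq_mul]
  have hp0_pos : ∀ᵐ x ∂P, 0 < p0 x := by
    rw [hP, ae_withDensity_iff hp0_meas.ennreal_ofReal]
    exact ae_of_all _ fun x hx => by simpa using hx
  have hPμ : P ≪ μ := withDensity_absolutelyContinuous _ _
  have hKL (η : Θ) : Integrable (fun x => Real.log (p0 x / p η x)) P :=
    (hint_iff _).2 (hKL_int η)
  have hlog_eq (η : Θ) : (fun x => Real.log (p0 x / p θstar x) - Real.log (p0 x / p η x))
      =ᵐ[P] fun x => Real.log (p η x / p θstar x) := by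
    filter_upwards [hp0_pos, hp_pos η, hp_pos θstar] with x h0 h1 h2
    rw [Real.log_div h0.ne' h2.ne', Real.log_div h0.ne' h1.ne', Real.log_div h1.ne' h2.ne']
    ring
  have hlog_int (η : Θ) : Integrable (fun x => Real.log (p η x / p θstar x)) P :=
    ((hKL θstar).sub (hKL η)).congr (hlog_eq η)
  have hlog_le (η : Θ) : ∫ x, Real.log (p η x / p θstar x) ∂P ≤ 0 := by
    rw [← integral_congr_ae (hlog_eq η), integral_sub (hKL θstar) (hKL η), hint_eq, hint_eq]
    exact sub_nonpos.2 (hθstar η)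
  have hr_pos : ∀ᵐ x ∂P, 0 < p θ x / p θstar x := by
    filter_upwards [hp_pos θ, hp_pos θstar] with x h1 h2
    exact div_pos h1 h2
  obtain ⟨hr_int, hr_le⟩ := integrable_and_integral_le_one_of_integral_log_nonpos
    ((hp_meas θ).div (hp_meas θstar)) hr_pos (hlog_int θ) fun t ht0 ht1 => by
      obtain ⟨η, hη⟩ := hconvex θ θstar t ht0 ht1
      have heq : (fun x => Real.log (p η x / p θstar x)) =ᵐ[P]
          fun x => Real.log (1 + t * (p θ x / p θstar x - 1)) := by
        filter_upwards [hPμ.ae_le hη, hp_pos θstar] with x hx h2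
        rw [hx]
        congr 1
        field_simp
        ring
      exact ⟨(hlog_int η).congr heq, (integral_congr_ae heq).symm.trans_le (hlog_le η)⟩
  obtain ⟨hhell, hA_pos⟩ :=
    integral_one_sub_sqrt_sq_le_and_integral_sqrt_pos hr_pos hr_int hr_le
  have hA : ∫ x, (p θ x / p θstar x) ^ ((1 : ℝ) / 2) * p0 x ∂μ
      = ∫ x, √(p θ x / p θstar x) ∂P := by
    simp only [hint_eq, Real.sqrt_eq_rpow, mul_comm]
  have hH : ∫ x, (√(p θstar x) - √(p θ x)) ^ 2 * (p0 x / p θstar x) ∂μ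
      ≤ ∫ x, (1 - √(p θ x / p θstar x)) ^ 2 ∂P := by
    rw [hint_eq]
    have hae := (ae_withDensity_iff hp0_meas.ennreal_ofReal).1 (hp_pos θstar)
    refine (integral_congr_ae ?_).le
    filter_upwards [hae] with x hx
    rcases (hp0_nonneg x).eq_or_lt with h0 | h0
    · simp [← h0]
    · have h2 : 0 < p θstar x := hx (by simpa using h0)
      rw [Real.sqrt_div (hp_nonneg θ x), one_sub_div (Real.sqrt_pos.2 h2).ne', div_pow,
        Real.sq_sqrt h2.le]
      ring
  refine ⟨?_, ?_⟩
  · rw [weightedHellingerSq, hA]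
    linarith
  · rw [alphaDiv, alphaAff, hA]
    have := Real.log_le_sub_one_of_pos hA_pos
    norm_num
    linarith
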